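/- Let r be a positive integer, let Σ be a closed subset of ℝⁿ with 0 ∈ Σ, and let f: (ℝⁿ,0) → (ℝᵖ,0) be a C^{r+1} map-germ with n ≥ p. If f satisfies the second relative Kuo condition (K_Σ^δ), then the relative r-jet j^r f(Σ;0) is Σ-V-sufficient in C^{r+1} mappings. -/

import Mathlib

/-- The Kuo distance `κ(v₁,…,v_p) = min_i dist(v_i, span{v_j : j ≠ i})`. -/
noncomputable def kuo {n p : ℕ} (v : Fin p → EuclideanSpace ℝ (Fin n)) : ℝ :=
  ⨅ i : Fin p, Metric.infDist (v i)
    (Submodule.span ℝ (v '' {j | j ≠ i}) : Set (EuclideanSpace ℝ (Fin n)))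

/-- The gradient of the `i`-th component of `f` at `x`, i.e. `df*(x)` applied to the
`i`-th standard basis vector. -/
noncomputable def grad {n p : ℕ} (f : EuclideanSpace ℝ (Fin n) → EuclideanSpace ℝ (Fin p))
    (x : EuclideanSpace ℝ (Fin n)) (i : Fin p) : EuclideanSpace ℝ (Fin n) :=
  ContinuousLinearMap.adjoint (fderiv ℝ f x) (EuclideanSpace.single i 1)

/-- `κ(df(x)) = κ(grad f₁(x),…,grad f_p(x))`. -/
noncomputable def kuoD {n p : ℕ} (f : EuclideanSpace ℝ (Fin n) → EuclideanSpace ℝ (Fin p))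
    (x : EuclideanSpace ℝ (Fin n)) : ℝ :=
  kuo (grad f x)

/-- `j^r f(Σ;0) = j^r g(Σ;0)`: all partial derivatives of order ≤ r of `f` and `g`
coincide on `Σ ∩ U` for some neighbourhood `U` of the origin. -/
def jetEqual {n p : ℕ} (r : ℕ) (S : Set (EuclideanSpace ℝ (Fin n)))
    (f g : EuclideanSpace ℝ (Fin n) → EuclideanSpace ℝ (Fin p)) : Prop :=
  ∃ U ∈ nhds (0 : EuclideanSpace ℝ (Fin n)), ∀ z ∈ S ∩ U, ∀ k : ℕ, k ≤ r →
    iteratedFDeriv ℝ k f z = iteratedFDeriv ℝ k g z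

/-- The second relative Kuo condition `(K_Σ^δ)`. -/
def KuoDeltaRel {n p : ℕ} (r : ℕ) (S : Set (EuclideanSpace ℝ (Fin n)))
    (f : EuclideanSpace ℝ (Fin n) → EuclideanSpace ℝ (Fin p)) : Prop :=
  ∀ g : EuclideanSpace ℝ (Fin n) → EuclideanSpace ℝ (Fin p),
    ContDiff ℝ (r + 1) g → g 0 = 0 → jetEqual r S f g →
    ∃ C > (0:ℝ), ∃ α > (0:ℝ), ∃ δ > (0:ℝ), ∃ w > (0:ℝ),
      ∀ x : EuclideanSpace ℝ (Fin n), ‖x‖ < α →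
        ‖g x‖ ≤ w * Metric.infDist x S ^ (r + 1) →
        kuoD f x ≥ C * Metric.infDist x S ^ ((r : ℝ) - δ)

/-- The relative r-jet `j^r f(Σ;0)` is `Σ`-`V`-sufficient in `C^s` mappings: any two `C^s`
realisations `g₁, g₂` of the relative jet have zero sets homeomorphic near the origin by a
homeomorphism fixing the points of `Σ`. -/
def SigmaVSufficient {n p : ℕ} (r s : ℕ) (S : Set (EuclideanSpace ℝ (Fin n)))
    (f : EuclideanSpace ℝ (Fin n) → EuclideanSpace ℝ (Fin p)) : Prop :=
  ∀ g₁ g₂ : EuclideanSpace ℝ (Fin n) → EuclideanSpace ℝ (Fin p),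
    ContDiff ℝ s g₁ → ContDiff ℝ s g₂ → g₁ 0 = 0 → g₂ 0 = 0 →
    jetEqual r S f g₁ → jetEqual r S f g₂ →
    ∃ U ∈ nhds (0 : EuclideanSpace ℝ (Fin n)), ∃ V ∈ nhds (0 : EuclideanSpace ℝ (Fin n)),
      ∃ h : (g₁ ⁻¹' {0} ∩ U : Set (EuclideanSpace ℝ (Fin n))) ≃ₜ
            (g₂ ⁻¹' {0} ∩ V : Set (EuclideanSpace ℝ (Fin n))),
        ∀ x : (g₁ ⁻¹' {0} ∩ U : Set (EuclideanSpace ℝ (Fin n))),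
          (x : EuclideanSpace ℝ (Fin n)) ∈ S → ((h x : EuclideanSpace ℝ (Fin n)) = x)

open Set Metric Topology in
/-- A vector field that is locally Lipschitz off `S` is uniformly Lipschitz in space, and
continuous in time, on each compact set disjoint from `S`. -/
theorem exists_lipschitzOnWith_slices {E : Type*} [NormedAddCommGroup E]
    {S K : Set E} {V : ℝ → E → E}
    (hL : LocallyLipschitzOn (Icc (0 : ℝ) 1 ×ˢ Sᶜ) (Function.uncurry V))
    (hK : IsCompact K) (hKS : K ⊆ Sᶜ) :
    ∃ C : NNReal, (∀ t ∈ Icc (0 : ℝ) 1, LipschitzOnWith C (V t) K) ∧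
      ∀ x ∈ K, ContinuousOn (V · x) (Icc (0 : ℝ) 1) := by
  obtain ⟨C, hC⟩ := LocallyLipschitzOn.exists_lipschitzOnWith_of_compact
    (isCompact_Icc.prod hK) (hL.mono (prod_mono_right hKS))
  refine ⟨C, fun t ht x hx y hy => ?_, fun x hx => ?_⟩
  · simpa [Prod.edist_eq] using hC (mk_mem_prod ht hx) (mk_mem_prod ht hy)
  · exact hC.continuousOn.comp (f := fun t : ℝ => (t, x)) (by fun_prop)
      fun t ht => mk_mem_prod ht hx

open Set Metric Topology in
theorem closedBall_infDist_subset_compl {E : Type*} [NormedAddCommGroup E] {S : Set E}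
    {x : E} {ρ : ℝ} (h : ρ < infDist x S) :
    closedBall x ρ ⊆ Sᶜ := fun y hy hyS => by
  have := infDist_le_dist_of_mem hyS (x := x)
  rw [mem_closedBall, dist_comm] at hy
  linarith

open Set Metric Topology in
theorem infDist_pos_of_mem_closedBall {E : Type*} [NormedAddCommGroup E] {S : Set E}
    {x y : E} (hy : y ∈ closedBall x (infDist x S / 2)) (hx : 0 < infDist x S) : 0 < infDist y S := by
  have := infDist_le_infDist_add_dist (s := S) (x := x) (y := y)
  rw [mem_closedBall, dist_comm] at hy
  linarith

open Set Metric Topology in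
theorem locallyLipschitzOn_reverse {E : Type*} [NormedAddCommGroup E] {S : Set E} {V : ℝ → E → E}
    (hL : LocallyLipschitzOn (Icc (0 : ℝ) 1 ×ˢ Sᶜ) (Function.uncurry V)) :
    LocallyLipschitzOn (Icc (0 : ℝ) 1 ×ˢ Sᶜ) (Function.uncurry fun t x => -V (1 - t) x) := by
  rintro ⟨t, x⟩ ⟨ht, hx⟩
  have hmaps : MapsTo (fun z : ℝ × E => (1 - z.1, z.2)) (Icc (0 : ℝ) 1 ×ˢ Sᶜ)
      (Icc (0 : ℝ) 1 ×ˢ Sᶜ) := fun z hz => ⟨⟨by linarith [hz.1.2], by linarith [hz.1.1]⟩, hz.2⟩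
  obtain ⟨K, U, hU, hKU⟩ := hL (hmaps (mk_mem_prod ht hx))
  have hcont : Continuous fun z : ℝ × E => (1 - z.1, z.2) := by fun_prop
  refine ⟨K, _, (hcont.continuousWithinAt.tendsto_nhdsWithin hmaps) hU, fun y hy z hz => ?_⟩
  have := hKU hy hz
  simpa [Function.uncurry, Prod.edist_eq, edist_neg_neg, edist_sub_left] using this

/-- `γ` solves `γ' = V(t, γ)` on `[0, 1]`. -/
def IsTrajectory {E : Type*} [NormedAddCommGroup E] [NormedSpace ℝ E] (V : ℝ → E → E)
    (γ : ℝ → E) : Prop :=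
  ∀ t ∈ Set.Icc (0 : ℝ) 1, HasDerivWithinAt γ (V t (γ t)) (Set.Icc 0 1) t

section Flow

open Set Metric Topology

variable {E : Type*} [NormedAddCommGroup E] [NormedSpace ℝ E] {S : Set E} {V : ℝ → E → E}

theorem IsTrajectory.continuousOn {γ : ℝ → E} (h : IsTrajectory V γ) :
    ContinuousOn γ (Icc 0 1) := fun t ht => (h t ht).continuousWithinAt

theorem HasDerivWithinAt.Icc_to_Ici {F : Type*} [NormedAddCommGroup F] [NormedSpace ℝ F]
    {γ : ℝ → F} {v : F} {t a b : ℝ} (h : HasDerivWithinAt γ v (Icc a b) t) (ht : t ∈ Ico a b) :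
    HasDerivWithinAt γ v (Ici t) t :=
  h.mono_of_mem_nhdsWithin (Filter.mem_of_superset (Icc_mem_nhdsGE ht.2) (Icc_subset_Icc_left ht.1))

theorem HasDerivWithinAt.reverse_Icc {F : Type*} [NormedAddCommGroup F] [NormedSpace ℝ F]
    {γ : ℝ → F} {v : F} {t : ℝ} (h : HasDerivWithinAt γ v (Icc 0 1) (1 - t)) :
    HasDerivWithinAt (fun s => γ (1 - s)) (-v) (Icc 0 1) t := by
  have h1 : HasDerivWithinAt (fun s : ℝ => 1 - s) (-1) (Icc 0 1) t := by
    simpa using (hasDerivWithinAt_id t (Icc (0 : ℝ) 1)).const_sub 1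
  have := h.scomp t h1 fun s hs => ⟨by linarith [hs.2], by linarith [hs.1]⟩
  simpa [Function.comp_def] using this

theorem IsTrajectory.reverse {γ : ℝ → E} (h : IsTrajectory V γ) :
    IsTrajectory (fun t x => -V (1 - t) x) (fun t => γ (1 - t)) := fun t ht =>
  (h (1 - t) ⟨by linarith [ht.2], by linarith [ht.1]⟩).reverse_Icc

/-- Two trajectories in a compact set off `S` are separated at most by a constant factor. -/
theorem exists_dist_trajectory_le {K : Set E}
    (hL : LocallyLipschitzOn (Icc (0 : ℝ) 1 ×ˢ Sᶜ) (Function.uncurry V))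
    (hK : IsCompact K) (hKS : K ⊆ Sᶜ) :
    ∃ C : ℝ, ∀ γ η : ℝ → E, IsTrajectory V γ → IsTrajectory V η →
      (∀ t ∈ Icc (0 : ℝ) 1, γ t ∈ K) → (∀ t ∈ Icc (0 : ℝ) 1, η t ∈ K) →
      dist (γ 1) (η 1) ≤ dist (γ 0) (η 0) * C := by
  obtain ⟨C, hC, -⟩ := exists_lipschitzOnWith_slices hL hK hKS
  refine ⟨Real.exp (C * (1 - 0)), fun γ η hγ hη hγK hηK => ?_⟩
  exact dist_le_of_trajectories_ODE_of_mem (v := V) (s := fun _ => K)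
    (fun t ht => hC t (Ico_subset_Icc_self ht)) hγ.continuousOn
    (fun t ht => (hγ t (Ico_subset_Icc_self ht)).Icc_to_Ici ht)
    (fun t ht => hγK t (Ico_subset_Icc_self ht)) hη.continuousOn
    (fun t ht => (hη t (Ico_subset_Icc_self ht)).Icc_to_Ici ht)
    (fun t ht => hηK t (Ico_subset_Icc_self ht)) le_rfl 1 (by simp)

theorem exists_trajectory [CompleteSpace E] [ProperSpace E] (hS : IsClosed S)
    (hb : ∀ t ∈ Icc (0 : ℝ) 1, ∀ x, ‖V t x‖ ≤ infDist x S / 4)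
    (hL : LocallyLipschitzOn (Icc (0 : ℝ) 1 ×ˢ Sᶜ) (Function.uncurry V)) (hne : S.Nonempty) (x : E) :
    ∃ γ : ℝ → E, γ 0 = x ∧ IsTrajectory V γ ∧
      ∀ t ∈ Icc (0 : ℝ) 1, γ t ∈ closedBall x (infDist x S / 2) := by
  by_cases hx : x ∈ S
  · refine ⟨fun _ => x, rfl, fun t ht => ?_, fun t _ => ?_⟩
    · have h0 : V t x = 0 := by simpa [infDist_zero_of_mem hx] using hb t ht x
      simpa [h0] using hasDerivWithinAt_const t (Icc (0 : ℝ) 1) x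
    · simp [infDist_zero_of_mem hx]
  have hd : 0 < infDist x S := (hS.notMem_iff_infDist_pos hne).1 hx
  set a : NNReal := ⟨infDist x S / 2, by positivity⟩ with ha
  have haE : (a : ℝ) = infDist x S / 2 := rfl
  obtain ⟨C, hC, hcont⟩ := exists_lipschitzOnWith_slices hL
    (isCompact_closedBall x (a : ℝ)) (closedBall_infDist_subset_compl (by rw [haE]; linarith))
  have hpl : IsPicardLindelof V (tmin := 0) (tmax := 1) ⟨0, by simp⟩ x a 0 a C := by
    refine ⟨hC, hcont, fun t ht y hy => (hb t ht y).trans ?_, by simp⟩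
    have := infDist_le_infDist_add_dist (s := S) (x := y) (y := x)
    rw [mem_closedBall] at hy
    linarith
  have hx0 : x ∈ closedBall x ((0 : NNReal) : ℝ) := by simp
  obtain ⟨α, hα⟩ := ODE.FunSpace.exists_isFixedPt_next hpl hx0
  refine ⟨α.compProj, ?_, fun t ht => ?_, fun t ht => α.compProj_mem_closedBall hpl.mul_max_le⟩
  · have : α.compProj ((⟨0, by simp⟩ : Icc (0 : ℝ) 1) : ℝ) = x := by
      rw [ODE.FunSpace.compProj_val, ← hα, ODE.FunSpace.next_apply₀]
    exact this
  · have := ODE.hasDerivWithinAt_picard_Icc (t₀ := 0) (by simp) hpl.continuousOn_uncurry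
      α.continuous_compProj.continuousOn
      (fun t' ht' => α.compProj_mem_closedBall hpl.mul_max_le) x ht
    refine this.congr_of_mem (fun t' ht' => ?_) ht
    nth_rw 1 [← hα]
    rw [ODE.FunSpace.compProj_of_mem ht', ODE.FunSpace.next_apply]

/-- The time-one map of a vector field that is locally Lipschitz off a closed set `S` and
bounded by a quarter of the distance to `S`. -/
theorem exists_continuous_timeOne [CompleteSpace E] [ProperSpace E] (hS : IsClosed S)
    (hne : S.Nonempty) (hb : ∀ t ∈ Icc (0 : ℝ) 1, ∀ x, ‖V t x‖ ≤ infDist x S / 4)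
    (hL : LocallyLipschitzOn (Icc (0 : ℝ) 1 ×ˢ Sᶜ) (Function.uncurry V)) :
    ∃ Φ : E → ℝ → E, Continuous (fun x => Φ x 1) ∧ ∀ x, Φ x 0 = x ∧ IsTrajectory V (Φ x) ∧
      ∀ t ∈ Icc (0 : ℝ) 1, Φ x t ∈ closedBall x (infDist x S / 2) := by
  choose Φ h0 htraj hball using exists_trajectory hS hb hL hne
  refine ⟨Φ, continuous_iff_continuousAt.2 fun x => ?_, fun x => ⟨h0 x, htraj x, hball x⟩⟩
  have h1 : (1 : ℝ) ∈ Icc (0 : ℝ) 1 := by simp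
  by_cases hx : x ∈ S
  · have hΦx : Φ x 1 = x := by simpa [infDist_zero_of_mem hx] using hball x 1 h1
    refine continuousAt_of_locally_lipschitz zero_lt_one 2 fun y _ => ?_
    rw [hΦx]
    have h2 := hball y 1 h1
    have h3 := infDist_le_dist_of_mem hx (x := y)
    rw [mem_closedBall] at h2
    have := dist_triangle (Φ y 1) y x
    have := dist_nonneg (x := y) (y := x)
    linarith
  have hd : 0 < infDist x S := (hS.notMem_iff_infDist_pos hne).1 hx
  obtain ⟨C, hC⟩ := exists_dist_trajectory_le hL
    (isCompact_closedBall x (3 / 4 * infDist x S)) (closedBall_infDist_subset_compl (by linarith))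
  refine continuousAt_of_locally_lipschitz (r := infDist x S / 10) (by positivity) C fun y hy => ?_
  have key : ∀ z, dist z x < infDist x S / 10 → ∀ t ∈ Icc (0 : ℝ) 1,
      Φ z t ∈ closedBall x (3 / 4 * infDist x S) := fun z hz t ht => by
    have h2 := hball z t ht
    rw [mem_closedBall] at h2 ⊢
    have := dist_triangle (Φ z t) z x
    have := infDist_le_infDist_add_dist (s := S) (x := z) (y := x)
    linarith
  have := hC _ _ (htraj y) (htraj x) (key y hy) (key x (by simpa using by positivity))
  rw [h0, h0] at this
  linarith

theorem timeOne_reverse_timeOne [ProperSpace E] (hS : IsClosed S) (hne : S.Nonempty)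
    {x : E} {γ η : ℝ → E}
    (hγ0 : γ 0 = x) (hγ : IsTrajectory V γ)
    (hγb : ∀ t ∈ Icc (0 : ℝ) 1, γ t ∈ closedBall x (infDist x S / 2))
    (hη0 : η 0 = γ 1) (hη : IsTrajectory (fun t x => -V (1 - t) x) η)
    (hηb : ∀ t ∈ Icc (0 : ℝ) 1, η t ∈ closedBall (γ 1) (infDist (γ 1) S / 2))
    (hL' : LocallyLipschitzOn (Icc (0 : ℝ) 1 ×ˢ Sᶜ)
      (Function.uncurry fun t x => -V (1 - t) x)) : η 1 = x := by
  have h1 : (1 : ℝ) ∈ Icc (0 : ℝ) 1 := by simp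
  by_cases hx : x ∈ S
  · have hγ1 : γ 1 = x := by simpa [infDist_zero_of_mem hx] using hγb 1 h1
    simpa [hγ1, infDist_zero_of_mem hx] using hηb 1 h1
  have hd : 0 < infDist x S := (hS.notMem_iff_infDist_pos hne).1 hx
  have hd1 := infDist_pos_of_mem_closedBall (hγb 1 h1) hd
  obtain ⟨C, hC⟩ := exists_dist_trajectory_le hL'
    ((isCompact_closedBall x (infDist x S / 2)).union
      (isCompact_closedBall (γ 1) (infDist (γ 1) S / 2)))
    (union_subset (closedBall_infDist_subset_compl (by linarith))
      (closedBall_infDist_subset_compl (by linarith)))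
  have := hC _ _ hη hγ.reverse (fun t ht => .inr (hηb t ht))
    (fun t ht => .inl (hγb _ ⟨by linarith [ht.2], by linarith [ht.1]⟩))
  rw [hη0] at this
  simpa [hγ0] using this

theorem exists_homeomorph_timeOne [CompleteSpace E] [ProperSpace E] (hS : IsClosed S)
    (hne : S.Nonempty) (hb : ∀ t ∈ Icc (0 : ℝ) 1, ∀ x, ‖V t x‖ ≤ infDist x S / 4)
    (hL : LocallyLipschitzOn (Icc (0 : ℝ) 1 ×ˢ Sᶜ) (Function.uncurry V)) :
    ∃ H : E ≃ₜ E, ∀ x, ∃ γ : ℝ → E, γ 0 = x ∧ γ 1 = H x ∧ IsTrajectory V γ ∧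
      ∀ t ∈ Icc (0 : ℝ) 1, γ t ∈ closedBall x (infDist x S / 2) := by
  have hL' := locallyLipschitzOn_reverse hL
  obtain ⟨Φ, hΦ, h⟩ := exists_continuous_timeOne hS hne hb hL
  obtain ⟨Ψ, hΨ, h'⟩ := exists_continuous_timeOne (V := fun t x => -V (1 - t) x) hS hne
    (fun t ht x => by
      simpa using hb (1 - t) ⟨by linarith [ht.2], by linarith [ht.1]⟩ x) hL'
  refine ⟨⟨⟨fun x => Φ x 1, fun x => Ψ x 1, fun x => ?_, fun x => ?_⟩, hΦ, hΨ⟩,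
    fun x => ⟨Φ x, (h x).1, rfl, (h x).2⟩⟩
  · exact timeOne_reverse_timeOne hS hne (h x).1 (h x).2.1 (h x).2.2 (h' _).1 (h' _).2.1
      (h' _).2.2 hL'
  · refine timeOne_reverse_timeOne hS hne (h' x).1 (h' x).2.1 (h' x).2.2 (h _).1 ?_
      (h _).2.2 ?_
    · simpa using (h (Ψ x 1)).2.1
    · simpa using hL

end Flow

open Metric Topology in
/-- A map whose derivatives of order `< m` vanish on `S` near `0` is `O(d(x, S)^m)` near `0`. -/
theorem exists_norm_le_infDist_pow {E : Type} [NormedAddCommGroup E] [NormedSpace ℝ E]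
    [ProperSpace E] {S : Set E} (hS : IsClosed S) (h0S : (0 : E) ∈ S) (m : ℕ) :
    ∀ {F : Type} [NormedAddCommGroup F] [NormedSpace ℝ F] (h : E → F), ContDiff ℝ m h →
      (∃ U ∈ 𝓝 (0 : E), ∀ z ∈ S ∩ U, ∀ k < m, iteratedFDeriv ℝ k h z = 0) →
      ∃ K ≥ (0 : ℝ), ∃ α > (0 : ℝ), ∀ x, ‖x‖ < α → ‖h x‖ ≤ K * infDist x S ^ m := by
  induction m with
  | zero =>
    intro F _ _ h hh _
    have := (hh.continuous.norm.continuousAt (x := 0)).eventually (gt_mem_nhds (lt_add_one ‖h 0‖))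
    obtain ⟨α, hα, hball⟩ := Metric.eventually_nhds_iff.1 this
    exact ⟨‖h 0‖ + 1, by positivity, α, hα, fun x hx => by simpa using (hball (by simpa)).le⟩
  | succ m ih =>
    rintro F _ _ h hh ⟨U, hU, hflat⟩
    have hdh : ContDiff ℝ m (fderiv ℝ h) := hh.fderiv_right (by norm_cast)
    obtain ⟨K, hK, α, hα, hbd⟩ := ih (fderiv ℝ h) hdh ⟨U, hU, fun z hz k hk => by
      rw [← norm_eq_zero, norm_iteratedFDeriv_fderiv, hflat z hz _ (by omega), norm_zero]⟩
    obtain ⟨β, hβ, hball⟩ := Metric.mem_nhds_iff.1 hU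
    refine ⟨K, hK, min α β / 2, by positivity, fun x hx => ?_⟩
    obtain ⟨z, hzS, hz⟩ := hS.exists_infDist_eq_dist ⟨0, h0S⟩ x
    have hxd : dist x z ≤ ‖x‖ := by
      rw [← hz]; simpa using infDist_le_dist_of_mem h0S (x := x)
    have hzn : ‖z‖ < min α β := by
      have := dist_triangle z x 0
      rw [dist_comm z x, dist_zero_right, dist_zero_right] at this
      linarith
    have hxn : ‖x‖ < min α β := by linarith [norm_nonneg x]
    have hz0 : h z = 0 := by
      have := hflat z ⟨hzS, hball (by simpa using hzn.trans_le (min_le_right _ _))⟩ 0 (by omega)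
      rw [← norm_eq_zero, ← norm_iteratedFDeriv_zero (𝕜 := ℝ), this, norm_zero]
    have hseg : ∀ y ∈ segment ℝ z x, ‖fderiv ℝ h y‖ ≤ K * infDist x S ^ m := fun y hy => by
      have hyn : y ∈ ball (0 : E) (min α β) :=
        (convex_ball (0 : E) _).segment_subset (by simpa using hzn) (by simpa using hxn) hy
      refine (hbd y (lt_of_lt_of_le (by simpa using hyn) (min_le_left _ _))).trans ?_
      gcongr
      · exact infDist_nonneg
      · refine (infDist_le_dist_of_mem hzS).trans ?_
        rw [hz, dist_comm x z, ← dist_add_dist_of_mem_segment hy, dist_comm y z]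
        exact le_add_of_nonneg_right dist_nonneg
    have := (convex_segment z x).norm_image_sub_le_of_norm_fderiv_le (𝕜 := ℝ)
      (fun y _ => (hh.differentiable (by simp)).differentiableAt) hseg
      (left_mem_segment ℝ z x) (right_mem_segment ℝ z x)
    rw [hz0, sub_zero, ← dist_eq_norm, ← hz] at this
    rwa [pow_succ, ← mul_assoc]

theorem adjoint_apply_eq_sum_grad {n p : ℕ}
    (f : EuclideanSpace ℝ (Fin n) → EuclideanSpace ℝ (Fin p)) (x : EuclideanSpace ℝ (Fin n))
    (φ : EuclideanSpace ℝ (Fin p)) :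
    ContinuousLinearMap.adjoint (fderiv ℝ f x) φ = ∑ i, φ i • grad f x i := by
  conv_lhs => rw [← (EuclideanSpace.basisFun (Fin p) ℝ).sum_repr φ]
  simp [grad]

theorem kuo_mul_abs_le {n p : ℕ} (v : Fin p → EuclideanSpace ℝ (Fin n)) (c : Fin p → ℝ)
    (i : Fin p) : kuo v * |c i| ≤ ‖∑ j, c j • v j‖ := by
  by_cases hc : c i = 0
  · simp [hc]
  have h1 : kuo v ≤ Metric.infDist (v i)
      (Submodule.span ℝ (v '' {j | j ≠ i}) : Set (EuclideanSpace ℝ (Fin n))) :=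
    ciInf_le (f := fun i => Metric.infDist (v i)
      (Submodule.span ℝ (v '' {j | j ≠ i}) : Set (EuclideanSpace ℝ (Fin n))))
      ⟨0, by rintro _ ⟨i, rfl⟩; exact Metric.infDist_nonneg⟩ i
  set u : EuclideanSpace ℝ (Fin n) := -∑ j ∈ Finset.univ.erase i, (c j / c i) • v j with hu
  have hus : u ∈ Submodule.span ℝ (v '' {j | j ≠ i}) :=
    neg_mem (sum_mem fun j hj => Submodule.smul_mem _ _
      (Submodule.subset_span ⟨j, (Finset.mem_erase.1 hj).1, rfl⟩))
  have h2 : ∑ j, c j • v j = c i • (v i - u) := by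
    rw [hu, sub_neg_eq_add, smul_add, Finset.smul_sum,
      ← Finset.add_sum_erase _ _ (Finset.mem_univ i)]
    congr 1
    refine Finset.sum_congr rfl fun j _ => ?_
    rw [smul_smul, mul_div_cancel₀ _ hc]
  rw [h2, norm_smul, Real.norm_eq_abs, mul_comm]
  gcongr
  exact h1.trans ((Metric.infDist_le_dist_of_mem hus).trans_eq (dist_eq_norm _ _))

/-- The Kuo distance bounds the smallest singular value from below, up to the factor `p`. -/
theorem kuoD_mul_norm_le {n p : ℕ} (f : EuclideanSpace ℝ (Fin n) → EuclideanSpace ℝ (Fin p))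
    (x : EuclideanSpace ℝ (Fin n)) (φ : EuclideanSpace ℝ (Fin p)) :
    kuoD f x * ‖φ‖ ≤ p * ‖ContinuousLinearMap.adjoint (fderiv ℝ f x) φ‖ := by
  have hκ : 0 ≤ kuoD f x := Real.iInf_nonneg fun i => Metric.infDist_nonneg
  have h1 : ‖φ‖ ≤ ∑ i, |φ i| := by
    conv_lhs => rw [← (EuclideanSpace.basisFun (Fin p) ℝ).sum_repr φ]
    refine (norm_sum_le _ _).trans_eq ?_
    simp [norm_smul]
  calc kuoD f x * ‖φ‖ ≤ kuoD f x * ∑ i, |φ i| := by gcongr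
    _ = ∑ i, kuoD f x * |φ i| := Finset.mul_sum _ _ _
    _ ≤ ∑ _i : Fin p, ‖ContinuousLinearMap.adjoint (fderiv ℝ f x) φ‖ :=
        Finset.sum_le_sum fun i _ => by
          rw [adjoint_apply_eq_sum_grad]; exact kuo_mul_abs_le _ _ i
    _ = _ := by simp

/-- All derivatives of order `≤ r` of `θ` vanish at the points of `S` near the origin. -/
def FlatAlong {n p : ℕ} (r : ℕ) (S : Set (EuclideanSpace ℝ (Fin n)))
    (θ : EuclideanSpace ℝ (Fin n) → EuclideanSpace ℝ (Fin p)) : Prop :=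
  ∃ U ∈ nhds (0 : EuclideanSpace ℝ (Fin n)), ∀ z ∈ S ∩ U, ∀ k ≤ r, iteratedFDeriv ℝ k θ z = 0

section Estimates

open Metric Topology Set

variable {n p r : ℕ} {S : Set (EuclideanSpace ℝ (Fin n))}
  {f g θ : EuclideanSpace ℝ (Fin n) → EuclideanSpace ℝ (Fin p)}

theorem flatAlong_sub (hf : ContDiff ℝ (r + 1) f) (hg : ContDiff ℝ (r + 1) g)
    (h : jetEqual r S f g) : FlatAlong r S (g - f) := by
  obtain ⟨U, hU, hUeq⟩ := h
  refine ⟨U, hU, fun z hz k hk => ?_⟩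
  have hk' : (k : WithTop ℕ∞) ≤ r + 1 := by exact_mod_cast hk.trans (Nat.le_succ r)
  rw [iteratedFDeriv_sub_apply (hg.of_le hk').contDiffAt (hf.of_le hk').contDiffAt,
    hUeq z hz k hk, sub_self]

theorem FlatAlong.sub (hf : ContDiff ℝ (r + 1) f) (hg : ContDiff ℝ (r + 1) g)
    (h : FlatAlong r S f) (h' : FlatAlong r S g) : FlatAlong r S (f - g) := by
  obtain ⟨U, hU, hUeq⟩ := h
  obtain ⟨U', hU', hUeq'⟩ := h'
  refine ⟨U ∩ U', Filter.inter_mem hU hU', fun z hz k hk => ?_⟩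
  have hk' : (k : WithTop ℕ∞) ≤ r + 1 := by exact_mod_cast hk.trans (Nat.le_succ r)
  rw [iteratedFDeriv_sub_apply (hf.of_le hk').contDiffAt (hg.of_le hk').contDiffAt,
    hUeq z ⟨hz.1, hz.2.1⟩ k hk, hUeq' z ⟨hz.1, hz.2.2⟩ k hk, sub_self]

theorem jetEqual_add_smul (hg : ContDiff ℝ (r + 1) g) (hθ : ContDiff ℝ (r + 1) θ)
    (h : jetEqual r S f g) (h' : FlatAlong r S θ) (t : ℝ) : jetEqual r S f (g + t • θ) := by
  obtain ⟨U, hU, hUeq⟩ := h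
  obtain ⟨U', hU', hUeq'⟩ := h'
  refine ⟨U ∩ U', Filter.inter_mem hU hU', fun z hz k hk => ?_⟩
  have hk' : (k : WithTop ℕ∞) ≤ r + 1 := by exact_mod_cast hk.trans (Nat.le_succ r)
  have hs : ContDiffAt ℝ k (t • θ) z := ((hθ.of_le hk').const_smul t).contDiffAt
  rw [iteratedFDeriv_add_apply (hg.of_le hk').contDiffAt hs,
    iteratedFDeriv_const_smul_apply (hθ.of_le hk').contDiffAt,
    hUeq z ⟨hz.1, hz.2.1⟩ k hk, hUeq' z ⟨hz.1, hz.2.2⟩ k hk, smul_zero, add_zero]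

theorem FlatAlong.exists_bound (hS : IsClosed S) (h0S : (0 : EuclideanSpace ℝ (Fin n)) ∈ S)
    (hθ : ContDiff ℝ (r + 1) θ) (h : FlatAlong r S θ) :
    ∃ K > (0 : ℝ), ∃ α > (0 : ℝ), ∀ x, ‖x‖ < α →
      ‖θ x‖ ≤ K * infDist x S ^ (r + 1) ∧ ‖fderiv ℝ θ x‖ ≤ K * infDist x S ^ r := by
  obtain ⟨U, hU, hflat⟩ := h
  obtain ⟨K₁, hK₁, α₁, hα₁, h₁⟩ := exists_norm_le_infDist_pow hS h0S (r + 1) θ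
    (by exact_mod_cast hθ) ⟨U, hU, fun z hz k hk => hflat z hz k (by omega)⟩
  obtain ⟨K₂, hK₂, α₂, hα₂, h₂⟩ := exists_norm_le_infDist_pow hS h0S r (fderiv ℝ θ)
    (hθ.fderiv_right le_rfl) ⟨U, hU, fun z hz k hk => by
      rw [← norm_eq_zero, norm_iteratedFDeriv_fderiv, hflat z hz _ (by omega), norm_zero]⟩
  refine ⟨K₁ + K₂ + 1, by positivity, min α₁ α₂, by positivity, fun x hx => ⟨?_, ?_⟩⟩
  · refine (h₁ x (hx.trans_le (min_le_left _ _))).trans ?_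
    have : 0 ≤ infDist x S := infDist_nonneg
    gcongr
    linarith
  · refine (h₂ x (hx.trans_le (min_le_right _ _))).trans ?_
    have : 0 ≤ infDist x S := infDist_nonneg
    gcongr
    linarith

/-- Uniform form of the Kuo condition along the segment of realisations `g + t θ`: inside a horn
around the zero set, the smallest singular value of the derivative dominates `N d(x, S)^r`. -/
theorem KuoDeltaRel.exists_uniform_horn (hr : 1 ≤ r) (hp : 1 ≤ p) (hS : IsClosed S)
    (h0S : (0 : EuclideanSpace ℝ (Fin n)) ∈ S) (hf : ContDiff ℝ (r + 1) f)
    (hKd : KuoDeltaRel r S f) (hg : ContDiff ℝ (r + 1) g) (hθ : ContDiff ℝ (r + 1) θ)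
    (hg0 : g 0 = 0) (hθ0 : θ 0 = 0) (hfg : jetEqual r S f g) (hflat : FlatAlong r S θ)
    {N : ℝ} (hN : 0 < N) :
    ∃ α > (0 : ℝ), ∃ w > (0 : ℝ), ∀ t ∈ Icc (0 : ℝ) 1, ∀ x, ‖x‖ < α →
      ‖g x + t • θ x‖ ≤ w * infDist x S ^ (r + 1) → ∀ φ, N * infDist x S ^ r * ‖φ‖ ≤
        ‖ContinuousLinearMap.adjoint (fderiv ℝ g x + t • fderiv ℝ θ x) φ‖ := by
  obtain ⟨K, hK, a, ha, hθb⟩ := hflat.exists_bound hS h0S hθ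
  obtain ⟨K', hK', a', ha', hgb⟩ :=
    (flatAlong_sub hf hg hfg).exists_bound (θ := g - f) hS h0S (hg.sub hf)
  suffices h : ∃ α > (0 : ℝ), ∃ w > (0 : ℝ), ∀ t ∈ Icc (0 : ℝ) 1, t ∈ Icc (0 : ℝ) 1 →
      ∀ x, ‖x‖ < α → ‖g x + t • θ x‖ ≤ w * infDist x S ^ (r + 1) →
      ∀ φ, N * infDist x S ^ r * ‖φ‖ ≤
        ‖ContinuousLinearMap.adjoint (fderiv ℝ g x + t • fderiv ℝ θ x) φ‖ by
    obtain ⟨α, hα, w, hw, h⟩ := h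
    exact ⟨α, hα, w, hw, fun t ht => h t ht ht⟩
  refine isCompact_Icc.induction_on
    (p := fun T : Set ℝ => ∃ α > (0 : ℝ), ∃ w > (0 : ℝ), ∀ t ∈ T, t ∈ Icc (0 : ℝ) 1 →
      ∀ x, ‖x‖ < α → ‖g x + t • θ x‖ ≤ w * infDist x S ^ (r + 1) →
      ∀ φ, N * infDist x S ^ r * ‖φ‖ ≤
        ‖ContinuousLinearMap.adjoint (fderiv ℝ g x + t • fderiv ℝ θ x) φ‖)
    ⟨1, one_pos, 1, one_pos, by simp⟩ ?_ ?_ ?_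
  · rintro s t hst ⟨α, hα, w, hw, h⟩
    exact ⟨α, hα, w, hw, fun u hu => h u (hst hu)⟩
  · rintro s t ⟨α, hα, w, hw, h⟩ ⟨α', hα', w', hw', h'⟩
    refine ⟨min α α', by positivity, min w w', by positivity, fun u hu hu1 x hx hxw => ?_⟩
    have hd : 0 ≤ infDist x S ^ (r + 1) := pow_nonneg infDist_nonneg _
    rcases hu with hu | hu
    · exact h u hu hu1 x (hx.trans_le (min_le_left _ _))
        (hxw.trans (mul_le_mul_of_nonneg_right (min_le_left _ _) hd))
    · exact h' u hu hu1 x (hx.trans_le (min_le_right _ _))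
        (hxw.trans (mul_le_mul_of_nonneg_right (min_le_right _ _) hd))
  intro t₀ ht₀
  obtain ⟨C, hC, α, hα, δ, hδ, w, hw, h⟩ := hKd (g + t₀ • θ) (hg.add (hθ.const_smul t₀))
    (by simp [hg0, hθ0]) (jetEqual_add_smul hg hθ hfg hflat t₀)
  have hpp : (0 : ℝ) < p := by exact_mod_cast hp
  obtain ⟨d₀, hd₀, hd₀'⟩ : ∃ d₀ > (0 : ℝ), ∀ y, |y| < d₀ → y ^ δ < C / ((N + K + K') * p) := by
    have : ∀ᶠ y : ℝ in 𝓝 0, y ^ δ < C / ((N + K + K') * p) :=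
      (Real.continuousAt_rpow_const 0 δ (Or.inr hδ.le)).eventually_lt continuousAt_const
        (by rw [Real.zero_rpow hδ.ne']; positivity)
    simpa [Metric.eventually_nhds_iff] using this
  refine ⟨ball t₀ (w / (2 * K)), mem_nhdsWithin_of_mem_nhds (ball_mem_nhds _ (by positivity)),
    min (min α d₀) (min a a'), by positivity, w / 2, by positivity, fun t ht ht1 x hx hxw φ => ?_⟩
  have hxα : ‖x‖ < α := hx.trans_le ((min_le_left _ _).trans (min_le_left _ _))
  have hxd : ‖x‖ < d₀ := hx.trans_le ((min_le_left _ _).trans (min_le_right _ _))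
  have hxa : ‖x‖ < a := hx.trans_le ((min_le_right _ _).trans (min_le_left _ _))
  have hxa' : ‖x‖ < a' := hx.trans_le ((min_le_right _ _).trans (min_le_right _ _))
  rcases (infDist_nonneg (x := x) (s := S)).eq_or_lt with hd | hd
  · rw [← hd, zero_pow (by omega)]; simp
  have hDx : infDist x S ≤ ‖x‖ := by simpa using infDist_le_dist_of_mem h0S (x := x)
  have hG : ‖(g + t₀ • θ) x‖ ≤ w * infDist x S ^ (r + 1) := by
    have h1 : (g + t₀ • θ) x = (g x + t • θ x) + (t₀ - t) • θ x := by
      simp only [Pi.add_apply, Pi.smul_apply]; module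
    have h2 : ‖(t₀ - t) • θ x‖ ≤ w / (2 * K) * (K * infDist x S ^ (r + 1)) := by
      rw [norm_smul]
      refine mul_le_mul ?_ (hθb x hxa).1 (norm_nonneg _) (by positivity)
      rw [mem_ball, dist_comm, Real.dist_eq] at ht
      exact ht.le
    have h3 : w / (2 * K) * (K * infDist x S ^ (r + 1)) = w / 2 * infDist x S ^ (r + 1) := by
      field_simp
    rw [h1]
    refine (norm_add_le _ _).trans ?_
    linarith
  have hκ := h x hxα hG
  have hpow : (N + K + K') * p * infDist x S ^ r ≤ C * infDist x S ^ ((r : ℝ) - δ) := by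
    rw [Real.rpow_sub hd, Real.rpow_natCast, mul_div_assoc', le_div_iff₀ (by positivity)]
    have := hd₀' (infDist x S) (by rw [abs_of_pos hd]; linarith)
    rw [lt_div_iff₀ (by positivity)] at this
    nlinarith [pow_pos hd r]
  have h1 : (N + K + K') * infDist x S ^ r * ‖φ‖ ≤
      ‖ContinuousLinearMap.adjoint (fderiv ℝ f x) φ‖ := by
    refine le_of_mul_le_mul_left (le_trans ?_ (kuoD_mul_norm_le f x φ)) hpp
    calc (p : ℝ) * ((N + K + K') * infDist x S ^ r * ‖φ‖)
        = (N + K + K') * p * infDist x S ^ r * ‖φ‖ := by ring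
      _ ≤ kuoD f x * ‖φ‖ := by gcongr; exact hpow.trans hκ
  have hfd : fderiv ℝ (g - f) x = fderiv ℝ g x - fderiv ℝ f x :=
    fderiv_sub (hg.differentiable (by simp)).differentiableAt
      (hf.differentiable (by simp)).differentiableAt
  have h2 : ‖ContinuousLinearMap.adjoint (fderiv ℝ (g - f) x + t • fderiv ℝ θ x) φ‖ ≤
      (K + K') * infDist x S ^ r * ‖φ‖ := by
    refine (ContinuousLinearMap.le_opNorm _ _).trans ?_
    gcongr
    rw [LinearIsometryEquiv.norm_map]
    refine (norm_add_le _ _).trans ?_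
    rw [norm_smul, Real.norm_eq_abs, abs_of_nonneg ht1.1]
    have := (hgb x hxa').2
    have := mul_le_mul ht1.2 (hθb x hxa).2 (norm_nonneg _) zero_le_one
    linarith
  have h3 : fderiv ℝ f x =
      (fderiv ℝ g x + t • fderiv ℝ θ x) - (fderiv ℝ (g - f) x + t • fderiv ℝ θ x) := by
    rw [hfd]; abel
  rw [h3, map_sub, sub_apply] at h1
  have := norm_sub_le (ContinuousLinearMap.adjoint (fderiv ℝ g x + t • fderiv ℝ θ x) φ)
    (ContinuousLinearMap.adjoint (fderiv ℝ (g - f) x + t • fderiv ℝ θ x) φ)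
  linarith

end Estimates

section Correction

open ContinuousLinearMap

variable {E F : Type*} [NormedAddCommGroup E] [InnerProductSpace ℝ E] [CompleteSpace E]
  [NormedAddCommGroup F] [InnerProductSpace ℝ F] [CompleteSpace F]
  {A : E →L[ℝ] F} {s μ : ℝ}

/-- The regularised Gram operator `A Aᵀ + s`. -/
noncomputable def gram (A : E →L[ℝ] F) (s : ℝ) : F →L[ℝ] F :=
  A ∘L adjoint A + s • (1 : F →L[ℝ] F)

/-- The regularised least-squares solution `-Aᵀ (A Aᵀ + s)⁻¹ y` of `A v = -y`. -/
noncomputable def lsqCorrection (A : E →L[ℝ] F) (s : ℝ) (y : F) : E :=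
  -adjoint A (Ring.inverse (gram A s) y)

theorem inner_gram (φ : F) :
    inner ℝ (gram A s φ) φ = ‖adjoint A φ‖ ^ 2 + s * ‖φ‖ ^ 2 := by
  simp only [gram, add_apply, coe_comp, Function.comp_apply, smul_apply,
    inner_add_left, inner_smul_left]
  rw [← adjoint_inner_right, real_inner_self_eq_norm_sq]
  simp

theorem isUnit_gram [FiniteDimensional ℝ F] (hμ : 0 < μ)
    (h : ∀ φ, μ ^ 2 * ‖φ‖ ^ 2 ≤ ‖adjoint A φ‖ ^ 2 + s * ‖φ‖ ^ 2) : IsUnit (gram A s) := by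
  have hinj : Function.Injective (gram A s) := by
    refine (injective_iff_map_eq_zero _).2 fun φ hφ => ?_
    have h1 := h φ
    rw [← inner_gram, hφ, inner_zero_left] at h1
    have h2 : ‖φ‖ ^ 2 ≤ 0 := nonpos_of_mul_nonpos_right h1 (by positivity)
    simpa using le_antisymm h2 (by positivity)
  exact ContinuousLinearMap.isUnit_iff_bijective.2
    ⟨hinj, (LinearMap.injective_iff_surjective (f := (gram A s : F →ₗ[ℝ] F))).1 hinj⟩

theorem gram_inverse_apply [FiniteDimensional ℝ F] (hμ : 0 < μ)
    (h : ∀ φ, μ ^ 2 * ‖φ‖ ^ 2 ≤ ‖adjoint A φ‖ ^ 2 + s * ‖φ‖ ^ 2) (y : F) :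
    gram A s (Ring.inverse (gram A s) y) = y := by
  simpa using congrArg (· y) (Ring.mul_inverse_cancel _ (isUnit_gram hμ h))

theorem norm_gram_inverse_le [FiniteDimensional ℝ F] (hμ : 0 < μ)
    (h : ∀ φ, μ ^ 2 * ‖φ‖ ^ 2 ≤ ‖adjoint A φ‖ ^ 2 + s * ‖φ‖ ^ 2) (y : F) :
    μ ^ 2 * ‖Ring.inverse (gram A s) y‖ ≤ ‖y‖ := by
  set φ := Ring.inverse (gram A s) y
  have h1 := h φ
  rw [← inner_gram, gram_inverse_apply hμ h] at h1
  rcases (norm_nonneg φ).eq_or_lt with h0 | h0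
  · rw [← h0]; simp
  refine le_of_mul_le_mul_right ?_ h0
  have := real_inner_le_norm y φ
  nlinarith

theorem norm_lsqCorrection_le [FiniteDimensional ℝ F] (hμ : 0 < μ) (hs : 0 ≤ s)
    (h : ∀ φ, μ ^ 2 * ‖φ‖ ^ 2 ≤ ‖adjoint A φ‖ ^ 2 + s * ‖φ‖ ^ 2) (y : F) :
    μ * ‖lsqCorrection A s y‖ ≤ ‖y‖ := by
  rw [lsqCorrection, norm_neg]
  have h1 := norm_gram_inverse_le hμ h y
  set φ := Ring.inverse (gram A s) y
  have h2 := inner_gram (A := A) (s := s) φ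
  rw [gram_inverse_apply hμ h] at h2
  have h3 := real_inner_le_norm y φ
  refine le_of_sq_le_sq ?_ (norm_nonneg y)
  calc (μ * ‖adjoint A φ‖) ^ 2 = μ ^ 2 * ‖adjoint A φ‖ ^ 2 := by ring
    _ ≤ μ ^ 2 * (‖y‖ * ‖φ‖) := by
      gcongr
      nlinarith [sq_nonneg ‖φ‖]
    _ = ‖y‖ * (μ ^ 2 * ‖φ‖) := by ring
    _ ≤ ‖y‖ * ‖y‖ := by gcongr
    _ = ‖y‖ ^ 2 := by ring

theorem norm_apply_lsqCorrection_add_le [FiniteDimensional ℝ F] (hμ : 0 < μ) (hs : 0 ≤ s)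
    (h : ∀ φ, μ ^ 2 * ‖φ‖ ^ 2 ≤ ‖adjoint A φ‖ ^ 2 + s * ‖φ‖ ^ 2) (y : F) :
    μ ^ 2 * ‖A (lsqCorrection A s y) + y‖ ≤ s * ‖y‖ := by
  have h1 := norm_gram_inverse_le hμ h y
  have h2 : A (lsqCorrection A s y) + y = s • Ring.inverse (gram A s) y := by
    nth_rw 2 [← gram_inverse_apply hμ h y]
    simp [lsqCorrection, gram]
  rw [h2, norm_smul, Real.norm_eq_abs, abs_of_nonneg hs]
  nlinarith

/-- The adjoint as a real-linear continuous map. -/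
noncomputable def adjointL (E F : Type*) [NormedAddCommGroup E] [InnerProductSpace ℝ E]
    [CompleteSpace E] [NormedAddCommGroup F] [InnerProductSpace ℝ F] [CompleteSpace F] :
    (E →L[ℝ] F) →L[ℝ] (F →L[ℝ] E) :=
  LinearMap.mkContinuous
    { toFun := fun A => adjoint A
      map_add' := fun A B => map_add _ A B
      map_smul' := fun c A => by simp } 1 fun A => by simp

theorem ContDiffAt.lsqCorrection {G : Type*} [NormedAddCommGroup G] [NormedSpace ℝ G]
    {a : G → E →L[ℝ] F} {σ : G → ℝ} {y : G → F} {z : G} (ha : ContDiffAt ℝ 1 a z)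
    (hσ : ContDiffAt ℝ 1 σ z) (hy : ContDiffAt ℝ 1 y z) (hu : IsUnit (gram (a z) (σ z))) :
    ContDiffAt ℝ 1 (fun z => lsqCorrection (a z) (σ z) (y z)) z := by
  have hadj : ContDiffAt ℝ 1 (fun z => adjoint (a z)) z :=
    (adjointL E F).contDiff.contDiffAt.comp z ha
  have hgram : ContDiffAt ℝ 1 (fun z => gram (a z) (σ z)) z :=
    (ha.clm_comp hadj).add (hσ.smul contDiffAt_const)
  have hinv : ContDiffAt ℝ 1 (fun z => Ring.inverse (gram (a z) (σ z))) z := by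
    obtain ⟨u, hu⟩ := hu
    have h := contDiffAt_ringInverse (n := 1) ℝ u
    rw [hu] at h
    exact h.comp z hgram
  exact (hadj.clm_apply (hinv.clm_apply hy)).neg

end Correction

section Deformation

open Metric Topology Set

/-- A Lipschitz cutoff, equal to `1` on the ball of radius `β` and to `0` off the ball of radius
`2β`. -/
noncomputable def cutoff {E : Type*} [NormedAddCommGroup E] (β : ℝ) (x : E) : ℝ :=
  max 0 (min 1 (2 - ‖x‖ / β))

theorem cutoff_nonneg {E : Type*} [NormedAddCommGroup E] (β : ℝ) (x : E) : 0 ≤ cutoff β x :=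
  le_max_left _ _

theorem cutoff_le_one {E : Type*} [NormedAddCommGroup E] (β : ℝ) (x : E) : cutoff β x ≤ 1 :=
  max_le zero_le_one (min_le_left _ _)

theorem cutoff_eq_one {E : Type*} [NormedAddCommGroup E] {β : ℝ} (hβ : 0 < β) {x : E}
    (hx : ‖x‖ ≤ β) : cutoff β x = 1 := by
  have : ‖x‖ / β ≤ 1 := (div_le_one hβ).2 hx
  rw [cutoff, min_eq_left (by linarith), max_eq_right zero_le_one]

theorem cutoff_eq_zero {E : Type*} [NormedAddCommGroup E] {β : ℝ} (hβ : 0 < β) {x : E}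
    (hx : 2 * β ≤ ‖x‖) : cutoff β x = 0 := by
  have : 2 ≤ ‖x‖ / β := (le_div_iff₀ hβ).2 hx
  exact max_eq_left ((min_le_right _ _).trans (by linarith))

theorem locallyLipschitz_cutoff {E : Type*} [NormedAddCommGroup E] [NormedSpace ℝ E] (β : ℝ) :
    LocallyLipschitz (cutoff β : E → ℝ) := by
  have h1 : LocallyLipschitz fun y : ℝ => 2 - y / β :=
    (show ContDiff ℝ 1 fun y : ℝ => 2 - y / β by fun_prop).locallyLipschitz
  exact ((h1.comp lipschitzWith_one_norm.locallyLipschitz).const_min 1).const_max 0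

theorem ContDiffAt.exists_lipschitzOnWith_comp {X Y Z : Type*} [PseudoEMetricSpace X]
    [NormedAddCommGroup Y] [NormedSpace ℝ Y] [NormedAddCommGroup Z] [NormedSpace ℝ Z]
    {W : Y → Z} {q : X → Y} {z : X} (hW : ContDiffAt ℝ 1 W (q z)) (hq : LocallyLipschitz q) :
    ∃ C, ∃ U ∈ 𝓝 z, LipschitzOnWith C (W ∘ q) U := by
  obtain ⟨C, T, hT, hCT⟩ := hW.exists_lipschitzOnWith
  obtain ⟨C', U, hU, hCU⟩ := hq z
  exact ⟨C * C', U ∩ q ⁻¹' T, Filter.inter_mem hU (hq.continuous.continuousAt hT),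
    hCT.comp (hCU.mono inter_subset_left) fun y hy => hy.2⟩

variable {n p r : ℕ} {S : Set (EuclideanSpace ℝ (Fin n))}
  {f g θ : EuclideanSpace ℝ (Fin n) → EuclideanSpace ℝ (Fin p)} {lam β K : ℝ}

/-- The regularisation parameter `λ d(x, S)^(r-1) ‖g(x) + t θ(x)‖`. -/
noncomputable def regParam (r : ℕ) (S : Set (EuclideanSpace ℝ (Fin n)))
    (g θ : EuclideanSpace ℝ (Fin n) → EuclideanSpace ℝ (Fin p)) (lam t : ℝ)
    (x : EuclideanSpace ℝ (Fin n)) : ℝ :=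
  lam * infDist x S ^ (r - 1) * ‖g x + t • θ x‖

/-- The vector field whose time one map carries the zero set of `g` to that of `g + θ`. -/
noncomputable def deformField (r : ℕ) (S : Set (EuclideanSpace ℝ (Fin n)))
    (g θ : EuclideanSpace ℝ (Fin n) → EuclideanSpace ℝ (Fin p)) (lam β t : ℝ)
    (x : EuclideanSpace ℝ (Fin n)) : EuclideanSpace ℝ (Fin n) :=
  cutoff β x • lsqCorrection (fderiv ℝ g x + t • fderiv ℝ θ x) (regParam r S g θ lam t x) (θ x)

theorem regParam_nonneg (hlam : 0 ≤ lam) (t : ℝ) (x : EuclideanSpace ℝ (Fin n)) :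
    0 ≤ regParam r S g θ lam t x := by
  have : 0 ≤ infDist x S := infDist_nonneg
  unfold regParam; positivity

/-- On the ball of radius `3β`, `θ` is `O(d(x, S)^(r+1))` with constant `K`, and the regularised
Gram operator of `g + t θ` is bounded below by `(4 K d(x, S)^r)²`. -/
structure IsDeformable (r : ℕ) (S : Set (EuclideanSpace ℝ (Fin n)))
    (g θ : EuclideanSpace ℝ (Fin n) → EuclideanSpace ℝ (Fin p)) (lam β K : ℝ) : Prop where
  lam_nonneg : 0 ≤ lam
  radius_pos : 0 < β
  const_pos : 0 < K
  norm_le : ∀ x, ‖x‖ < 3 * β → ‖θ x‖ ≤ K * infDist x S ^ (r + 1)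
  le_gram : ∀ t ∈ Icc (0 : ℝ) 1, ∀ x, ‖x‖ < 3 * β → ∀ φ,
    (4 * K * infDist x S ^ r) ^ 2 * ‖φ‖ ^ 2 ≤
      ‖ContinuousLinearMap.adjoint (fderiv ℝ g x + t • fderiv ℝ θ x) φ‖ ^ 2 +
        regParam r S g θ lam t x * ‖φ‖ ^ 2

theorem KuoDeltaRel.exists_isDeformable (hr : 1 ≤ r) (hp : 1 ≤ p) (hS : IsClosed S)
    (h0S : (0 : EuclideanSpace ℝ (Fin n)) ∈ S) (hf : ContDiff ℝ (r + 1) f)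
    (hKd : KuoDeltaRel r S f) (hg : ContDiff ℝ (r + 1) g) (hθ : ContDiff ℝ (r + 1) θ)
    (hg0 : g 0 = 0) (hθ0 : θ 0 = 0) (hfg : jetEqual r S f g) (hflat : FlatAlong r S θ) :
    ∃ lam β K, IsDeformable r S g θ lam β K := by
  obtain ⟨K, hK, a, ha, hθb⟩ := hflat.exists_bound hS h0S hθ
  obtain ⟨α, hα, w, hw, h⟩ := hKd.exists_uniform_horn hr hp hS h0S hf hg hθ hg0 hθ0 hfg hflat
    (N := 4 * K) (by positivity)
  have hlam : 0 ≤ (4 * K) ^ 2 / w := by positivity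
  refine ⟨(4 * K) ^ 2 / w, min a α / 3, K, hlam, by positivity, hK,
    fun x hx => (hθb x ?_).1, fun t ht x hx φ => ?_⟩
  · linarith [min_le_left a α]
  have hd : 0 ≤ infDist x S := infDist_nonneg
  have hs : 0 ≤ regParam r S g θ ((4 * K) ^ 2 / w) t x := regParam_nonneg hlam t x
  by_cases hG : ‖g x + t • θ x‖ ≤ w * infDist x S ^ (r + 1)
  · have := h t ht x (by linarith [min_le_right a α]) hG φ
    have := pow_le_pow_left₀ (by positivity) this 2
    rw [mul_pow] at this
    nlinarith [sq_nonneg ‖φ‖]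
  · have h1 : (4 * K * infDist x S ^ r) ^ 2 ≤ regParam r S g θ ((4 * K) ^ 2 / w) t x := by
      calc (4 * K * infDist x S ^ r) ^ 2
          = (4 * K) ^ 2 / w * infDist x S ^ (r - 1) * (w * infDist x S ^ (r + 1)) := by
            obtain ⟨k, rfl⟩ := Nat.exists_eq_add_of_le' hr
            simp only [Nat.add_sub_cancel]
            field_simp
            ring
        _ ≤ _ := by unfold regParam; gcongr; exact (not_le.1 hG).le
    have := mul_le_mul_of_nonneg_right h1 (sq_nonneg ‖φ‖)
    have := sq_nonneg
      ‖ContinuousLinearMap.adjoint (fderiv ℝ g x + t • fderiv ℝ θ x) φ‖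
    linarith

namespace IsDeformable

theorem eq_zero (h : IsDeformable r S g θ lam β K)
    {x : EuclideanSpace ℝ (Fin n)} (hx : ‖x‖ < 3 * β) (hd : infDist x S = 0) :
    θ x = 0 := by
  simpa [hd] using h.norm_le x hx

theorem norm_deformField_le (h : IsDeformable r S g θ lam β K)
    {t : ℝ} (ht : t ∈ Icc (0 : ℝ) 1) (x : EuclideanSpace ℝ (Fin n)) :
    ‖deformField r S g θ lam β t x‖ ≤ infDist x S / 4 := by
  have hd : 0 ≤ infDist x S := infDist_nonneg
  rcases le_or_gt (2 * β) ‖x‖ with hx | hx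
  · rw [deformField, cutoff_eq_zero h.radius_pos hx, zero_smul, norm_zero]
    positivity
  have hx3 : ‖x‖ < 3 * β := by linarith [h.radius_pos]
  rcases hd.eq_or_lt with hd0 | hd0
  · simp [deformField, h.eq_zero hx3 hd0.symm, lsqCorrection, ← hd0]
  have hK := h.const_pos
  have h1 := norm_lsqCorrection_le (μ := 4 * K * infDist x S ^ r) (by positivity)
    (regParam_nonneg h.lam_nonneg t x) (h.le_gram t ht x hx3) (θ x)
  set c := lsqCorrection (fderiv ℝ g x + t • fderiv ℝ θ x) (regParam r S g θ lam t x) (θ x)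
  have h2 : ‖c‖ ≤ infDist x S / 4 := by
    refine le_of_mul_le_mul_left ((h1.trans (h.norm_le x hx3)).trans_eq ?_)
      (by positivity : 0 < 4 * K * infDist x S ^ r)
    ring
  rw [deformField, norm_smul, Real.norm_eq_abs, abs_of_nonneg (cutoff_nonneg _ _)]
  exact (mul_le_of_le_one_left (norm_nonneg _) (cutoff_le_one _ _)).trans h2

theorem norm_apply_deformField_add_le (h : IsDeformable r S g θ lam β K)
    (hr : 1 ≤ r) {t : ℝ} (ht : t ∈ Icc (0 : ℝ) 1)
    {x : EuclideanSpace ℝ (Fin n)} (hx : ‖x‖ ≤ β) :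
    ‖(fderiv ℝ g x + t • fderiv ℝ θ x) (deformField r S g θ lam β t x) + θ x‖ ≤
      lam / (16 * K) * ‖g x + t • θ x‖ := by
  have hd : 0 ≤ infDist x S := infDist_nonneg
  have hlam := h.lam_nonneg
  have hK := h.const_pos
  have hx3 : ‖x‖ < 3 * β := by linarith [h.radius_pos]
  rcases hd.eq_or_lt with hd0 | hd0
  · have : 0 ≤ lam / (16 * K) * ‖g x + t • θ x‖ := by positivity
    simpa [deformField, h.eq_zero hx3 hd0.symm, lsqCorrection] using this
  have hs := regParam_nonneg (r := r) (S := S) (g := g) (θ := θ) hlam t x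
  have h1 := norm_apply_lsqCorrection_add_le (μ := 4 * K * infDist x S ^ r) (by positivity)
    hs (h.le_gram t ht x hx3) (θ x)
  rw [deformField, cutoff_eq_one h.radius_pos hx, one_smul]
  refine le_of_mul_le_mul_left (h1.trans ?_)
    (by positivity : 0 < (4 * K * infDist x S ^ r) ^ 2)
  refine (mul_le_mul_of_nonneg_left (h.norm_le x hx3) hs).trans_eq ?_
  obtain ⟨k, rfl⟩ := Nat.exists_eq_add_of_le' hr
  simp only [regParam, Nat.add_sub_cancel]
  field_simp
  ring

theorem locallyLipschitzOn_deformField (h : IsDeformable r S g θ lam β K)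
    (hr : 1 ≤ r) (hS : IsClosed S) (hne : S.Nonempty)
    (hg : ContDiff ℝ (r + 1) g) (hθ : ContDiff ℝ (r + 1) θ) :
    LocallyLipschitzOn (Icc (0 : ℝ) 1 ×ˢ Sᶜ)
      (Function.uncurry (deformField r S g θ lam β)) := by
  rintro ⟨t, x⟩ ⟨ht, hx⟩
  suffices h : ∃ C, ∃ U ∈ 𝓝 (t, x),
      LipschitzOnWith C (Function.uncurry (deformField r S g θ lam β)) U by
    obtain ⟨C, U, hU, hCU⟩ := h
    exact ⟨C, U, mem_nhdsWithin_of_mem_nhds hU, hCU⟩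
  have hβ := h.radius_pos
  rcases lt_or_ge (2 * β) ‖x‖ with hxβ | hxβ
  · refine ⟨0, {z | 2 * β < ‖z.2‖},
      (isOpen_lt continuous_const (by fun_prop)).mem_nhds hxβ, fun y hy z hz => ?_⟩
    simp [Function.uncurry, deformField, cutoff_eq_zero hβ (le_of_lt hy),
      cutoff_eq_zero hβ (le_of_lt hz)]
  have hx3 : ‖x‖ < 3 * β := by linarith
  have hd : 0 < infDist x S := (hS.notMem_iff_infDist_pos hne).1 hx
  have hK := h.const_pos
  have hr1 : (1 : WithTop ℕ∞) ≤ r := by exact_mod_cast hr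
  have h1r : (1 : WithTop ℕ∞) ≤ r + 1 := hr1.trans le_self_add
  have hg1 : ContDiff ℝ 1 g := hg.of_le h1r
  have hθ1 : ContDiff ℝ 1 θ := hθ.of_le h1r
  have hdg : ContDiff ℝ 1 (fderiv ℝ g) := (hg.fderiv_right le_rfl).of_le hr1
  have hdθ : ContDiff ℝ 1 (fderiv ℝ θ) := (hθ.fderiv_right le_rfl).of_le hr1
  let q : ℝ × EuclideanSpace ℝ (Fin n) → (ℝ × EuclideanSpace ℝ (Fin n)) × (ℝ × ℝ × ℝ) :=
    fun z => (z, infDist z.2 S, ‖g z.2 + z.1 • θ z.2‖, cutoff β z.2)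
  have hsnd : LocallyLipschitz (Prod.snd : ℝ × EuclideanSpace ℝ (Fin n) → _) :=
    LipschitzWith.prod_snd.locallyLipschitz
  have hG : ContDiff ℝ 1 fun z : ℝ × EuclideanSpace ℝ (Fin n) => g z.2 + z.1 • θ z.2 :=
    (hg1.comp contDiff_snd).add (contDiff_fst.smul (hθ1.comp contDiff_snd))
  have hq : LocallyLipschitz q := LocallyLipschitz.id.prodMk
    (((lipschitz_infDist_pt S).locallyLipschitz.comp hsnd).prodMk
      ((lipschitzWith_one_norm.locallyLipschitz.comp hG.locallyLipschitz).prodMk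
        ((locallyLipschitz_cutoff β).comp hsnd)))
  let W : (ℝ × EuclideanSpace ℝ (Fin n)) × (ℝ × ℝ × ℝ) → EuclideanSpace ℝ (Fin n) := fun u =>
    u.2.2.2 • lsqCorrection (fderiv ℝ g u.1.2 + u.1.1 • fderiv ℝ θ u.1.2)
      (lam * u.2.1 ^ (r - 1) * u.2.2.1) (θ u.1.2)
  have hx' : ContDiff ℝ 1 fun u : (ℝ × EuclideanSpace ℝ (Fin n)) × (ℝ × ℝ × ℝ) => u.1.2 := by
    fun_prop
  have ht' : ContDiff ℝ 1 fun u : (ℝ × EuclideanSpace ℝ (Fin n)) × (ℝ × ℝ × ℝ) => u.1.1 := by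
    fun_prop
  have hσ : ContDiff ℝ 1 fun u : (ℝ × EuclideanSpace ℝ (Fin n)) × (ℝ × ℝ × ℝ) =>
      lam * u.2.1 ^ (r - 1) * u.2.2.1 := by fun_prop
  have hρ : ContDiff ℝ 1 fun u : (ℝ × EuclideanSpace ℝ (Fin n)) × (ℝ × ℝ × ℝ) => u.2.2.2 := by
    fun_prop
  have hW : ContDiffAt ℝ 1 W (q (t, x)) := hρ.contDiffAt.smul
    (ContDiffAt.lsqCorrection
      ((hdg.comp hx').add (ht'.smul (hdθ.comp hx'))).contDiffAt
      hσ.contDiffAt (hθ1.comp hx').contDiffAt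
      (isUnit_gram (by positivity : 0 < 4 * K * infDist x S ^ r) (h.le_gram t ht x hx3)))
  exact hW.exists_lipschitzOnWith_comp hq

theorem trajectory_eq_zero_iff (h : IsDeformable r S g θ lam β K)
    (hr : 1 ≤ r) (hg : Differentiable ℝ g) (hθ : Differentiable ℝ θ)
    {γ : ℝ → EuclideanSpace ℝ (Fin n)} (hγ : IsTrajectory (deformField r S g θ lam β) γ)
    (hball : ∀ t ∈ Icc (0 : ℝ) 1, ‖γ t‖ ≤ β) : g (γ 0) = 0 ↔ g (γ 1) + θ (γ 1) = 0 := by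
  set ψ : ℝ → EuclideanSpace ℝ (Fin p) := fun t => g (γ t) + t • θ (γ t) with hψ
  set ψ' : ℝ → EuclideanSpace ℝ (Fin p) := fun t =>
    (fderiv ℝ g (γ t) + t • fderiv ℝ θ (γ t)) (deformField r S g θ lam β t (γ t)) + θ (γ t)
    with hψ'
  have hder : ∀ t ∈ Icc (0 : ℝ) 1, HasDerivWithinAt ψ (ψ' t) (Icc 0 1) t := fun t ht => by
    have h1 := (hg (γ t)).hasFDerivAt.comp_hasDerivWithinAt t (hγ t ht)
    have h2 := (hθ (γ t)).hasFDerivAt.comp_hasDerivWithinAt t (hγ t ht)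
    refine (h1.add ((hasDerivWithinAt_id t _).smul h2)).congr_deriv ?_
    simp [hψ', add_assoc]
  have hbd : ∀ t ∈ Icc (0 : ℝ) 1, ‖ψ' t‖ ≤ lam / (16 * K) * ‖ψ t‖ := fun t ht =>
    h.norm_apply_deformField_add_le hr ht (hball t ht)
  have hcont : ContinuousOn ψ (Icc 0 1) := fun t ht => (hder t ht).continuousWithinAt
  have hmem : ∀ t ∈ Icc (0 : ℝ) 1, 1 - t ∈ Icc (0 : ℝ) 1 := fun t ht =>
    ⟨by linarith [ht.2], by linarith [ht.1]⟩
  have hrev : ∀ t ∈ Icc (0 : ℝ) 1,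
      HasDerivWithinAt (fun t => ψ (1 - t)) (-ψ' (1 - t)) (Icc 0 1) t := fun t ht =>
    (hder _ (hmem t ht)).reverse_Icc
  have h0 : ψ 0 = g (γ 0) := by simp [hψ]
  have h1 : ψ 1 = g (γ 1) + θ (γ 1) := by simp [hψ]
  rw [← h0, ← h1]
  constructor <;> intro hz
  · exact eq_zero_of_abs_deriv_le_mul_abs_self_of_eq_zero_right hcont
      (fun t ht => (hder t (Ico_subset_Icc_self ht)).Icc_to_Ici ht) hz
      (fun t ht => hbd t (Ico_subset_Icc_self ht)) 1 (by simp)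
  · have := eq_zero_of_abs_deriv_le_mul_abs_self_of_eq_zero_right
      (f := fun t => ψ (1 - t)) (fun t ht => (hrev t ht).continuousWithinAt)
      (fun t ht => (hrev t (Ico_subset_Icc_self ht)).Icc_to_Ici ht) (by simpa using hz)
      (fun t ht => by
        rw [norm_neg]; exact hbd _ (hmem t (Ico_subset_Icc_self ht))) 1 (by simp)
    simpa using this

end IsDeformable

end Deformation

/-- If `f` satisfies the second relative Kuo condition `(K_Σ^δ)`, then `j^r f(Σ;0)` is
`Σ`-`V`-sufficient in `C^{r+1}` mappings. -/
theorem stmt18 {n p r : ℕ} (hr : 1 ≤ r) (hp : 1 ≤ p) (hnp : p ≤ n)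
    (S : Set (EuclideanSpace ℝ (Fin n)))
    (hS : IsClosed S) (h0S : (0 : EuclideanSpace ℝ (Fin n)) ∈ S)
    (f : EuclideanSpace ℝ (Fin n) → EuclideanSpace ℝ (Fin p))
    (hf : ContDiff ℝ (r + 1) f) (hf0 : f 0 = 0)
    (hKd : KuoDeltaRel r S f) :
    SigmaVSufficient r (r + 1) S f := by
  intro g₁ g₂ hg₁ hg₂ hg₁0 hg₂0 hfg₁ hfg₂
  replace hg₁ : ContDiff ℝ (r + 1) g₁ := by exact_mod_cast hg₁
  replace hg₂ : ContDiff ℝ (r + 1) g₂ := by exact_mod_cast hg₂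
  have hflat : FlatAlong r S (g₂ - g₁) := by
    have := (flatAlong_sub hf hg₂ hfg₂).sub (f := g₂ - f) (g := g₁ - f) (hg₂.sub hf)
      (hg₁.sub hf) (flatAlong_sub hf hg₁ hfg₁)
    rwa [sub_sub_sub_cancel_right] at this
  have hθ : ContDiff ℝ (r + 1) (g₂ - g₁) := hg₂.sub hg₁
  obtain ⟨lam, β, K, h⟩ := hKd.exists_isDeformable hr hp hS h0S hf hg₁ hθ hg₁0
    (by simp [hg₁0, hg₂0]) hfg₁ hflat
  obtain ⟨H, hH⟩ := exists_homeomorph_timeOne hS ⟨0, h0S⟩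
    (fun t ht x => h.norm_deformField_le ht x)
    (h.locallyLipschitzOn_deformField hr hS ⟨0, h0S⟩ hg₁ hθ)
  have hfix : ∀ x ∈ S, H x = x := fun x hx => by
    obtain ⟨γ, -, hγ1, -, hγ⟩ := hH x
    simpa [Metric.infDist_zero_of_mem hx, hγ1] using hγ 1 (by simp)
  have hβ := h.radius_pos
  have hiff : ∀ x ∈ Metric.ball (0 : EuclideanSpace ℝ (Fin n)) (β / 2),
      (g₁ x = 0 ↔ g₂ (H x) = 0) := fun x hx => by
    obtain ⟨γ, hγ0, hγ1, htraj, hγ⟩ := hH x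
    have := h.trajectory_eq_zero_iff hr (hg₁.differentiable (by simp))
      (hθ.differentiable (by simp)) htraj fun t ht => by
        have h1 := hγ t ht
        have h2 : Metric.infDist x S ≤ ‖x‖ := by
          simpa using Metric.infDist_le_dist_of_mem h0S (x := x)
        rw [mem_closedBall_iff_norm, norm_sub_rev] at h1
        rw [mem_ball_zero_iff] at hx
        have h3 := norm_le_norm_add_norm_sub x (γ t)
        linarith
    simpa [hγ0, hγ1] using this
  have hU : Metric.ball (0 : EuclideanSpace ℝ (Fin n)) (β / 2) ∈ nhds 0 :=
    Metric.ball_mem_nhds _ (by positivity)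
  refine ⟨_, hU, H '' Metric.ball 0 (β / 2), ?_, H.subtype fun x => ?_, fun x hx => hfix x hx⟩
  · have := H.isOpenMap.image_mem_nhds hU
    rwa [hfix 0 h0S] at this
  · simp only [Set.mem_inter_iff, Set.mem_preimage, Set.mem_singleton_iff,
      H.injective.mem_set_image]
    exact and_congr_left (hiff x)
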